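/- Let (A, B) be a pair of n-by-n complex matrices and σ ∈ ℂ be such that A - σB is invertible. Let Z ∈ ℂ^{n×s} have orthonormal columns, and let U ∈ ℂ^{n×s} have orthonormal columns spanning the column space of (A - σB)Z. Then the projected pair (U* A Z, U* B Z) is regular; in particular det(U* A Z - σ U* B Z) ≠ 0. -/

import Mathlib

open Matrix

theorem stmt8 {n s : ℕ} (A B : Matrix (Fin n) (Fin n) ℂ) (σ : ℂ)
    (hinv : IsUnit (A - σ • B))
    (Z U : Matrix (Fin n) (Fin s) ℂ)
    (hZ : Zᴴ * Z = 1) (hU : Uᴴ * U = 1)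
    (hspan : Submodule.span ℂ (Set.range Uᵀ) =
      Submodule.span ℂ (Set.range ((A - σ • B) * Z)ᵀ)) :
    (∃ α β : ℂ, (β • (Uᴴ * A * Z) + α • (Uᴴ * B * Z)).det ≠ 0) ∧
      (Uᴴ * A * Z - σ • (Uᴴ * B * Z)).det ≠ 0 := by
  have hF : ∃ F : Matrix (Fin s) (Fin s) ℂ, (A - σ • B) * Z = U * F := by
    have h : ∀ j : Fin s, ∃ v : Fin s → ℂ, U *ᵥ v = ((A - σ • B) * Z)ᵀ j := by
      intro j
      have h1 : ((A - σ • B) * Z)ᵀ j ∈ Submodule.span ℂ (Set.range Uᵀ) := by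
        rw [hspan]
        exact Submodule.subset_span ⟨j, rfl⟩
      have h2 : ((A - σ • B) * Z)ᵀ j ∈ LinearMap.range U.mulVecLin := by
        rw [Matrix.range_mulVecLin]
        exact h1
      obtain ⟨v, hv⟩ := h2
      exact ⟨v, hv⟩
    choose v hv using h
    refine ⟨Matrix.of fun i j => v j i, ?_⟩
    ext i j
    exact (congrFun (hv j) i).symm
  obtain ⟨F, hF⟩ := hF
  obtain ⟨N, hN⟩ := hinv.exists_left_inv
  have hleft : (Zᴴ * N * U) * F = 1 := by
    rw [Matrix.mul_assoc, ← hF, Matrix.mul_assoc, ← Matrix.mul_assoc N, hN, Matrix.one_mul, hZ]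
  have hEq : Uᴴ * A * Z - σ • (Uᴴ * B * Z) = F := by
    calc Uᴴ * A * Z - σ • (Uᴴ * B * Z) = Uᴴ * ((A - σ • B) * Z) := by
          simp [Matrix.sub_mul, Matrix.mul_sub, Matrix.mul_assoc]
      _ = F := by rw [hF, ← Matrix.mul_assoc, hU, Matrix.one_mul]
  have hdet : (Uᴴ * A * Z - σ • (Uᴴ * B * Z)).det ≠ 0 := by
    rw [hEq]
    exact Matrix.det_ne_zero_of_left_inverse hleft
  refine ⟨⟨-σ, 1, ?_⟩, hdet⟩
  rw [one_smul, neg_smul, ← sub_eq_add_neg]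
  exact hdet
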